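/- For all 1 ≤ j < i ≤ n and ε ∈ {1,−1}, set G = gⱼ g_{j+1} ⋯ g_{i−2} g_{i−1} g_{i−2} ⋯ g_{j+1} gⱼ ∈ H_{2,n}(q) (so G = gⱼ when i = j+1). Then τᵢ^ε 𝒯ⱼ^{−ε} lies in the ℤ[q,q⁻¹]-submodule of H_{2,n}(q) spanned by the three elements 𝒯ⱼ^{−ε} τᵢ^ε, 𝒯ⱼ^{−ε} τⱼ^ε G^ε, and τᵢ^ε 𝒯ᵢ^{−ε} G^ε. (Lemma 3, item (3).) -/

import Mathlib

noncomputable section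

namespace MixedHecke

/-- The ring `ℤ[q,q⁻¹]` of Laurent polynomials over `ℤ`. -/
abbrev R : Type := LaurentPolynomial ℤ

/-- The variable `q`. -/
def q : R := LaurentPolynomial.T 1

/-- The inverse `q⁻¹` of the variable `q`. -/
def qinv : R := LaurentPolynomial.T (-1)

/-- Generators of the mixed braid group `B_{2,n}`:
`Sum.inl true` is `𝒯`, `Sum.inl false` is `τ`, and `Sum.inr ⟨i, _⟩` is `σ_i` for `1 ≤ i ≤ n-1`. -/
def Gen (n : ℕ) : Type := Bool ⊕ {i : ℕ // 1 ≤ i ∧ i < n}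

/-- The generator `𝒯` in the free group. -/
def fT (n : ℕ) : FreeGroup (Gen n) := FreeGroup.of (Sum.inl true)

/-- The generator `τ` in the free group. -/
def ftau (n : ℕ) : FreeGroup (Gen n) := FreeGroup.of (Sum.inl false)

/-- The generator `σ_i` in the free group (junk value `1` for `i` out of range). -/
def fs (n i : ℕ) : FreeGroup (Gen n) :=
  if h : 1 ≤ i ∧ i < n then FreeGroup.of (Sum.inr ⟨i, h⟩) else 1

/-- The defining relators of the mixed braid group `B_{2,n}`. -/
def rels (n : ℕ) : Set (FreeGroup (Gen n)) :=
  { x | (∃ k j, 1 ≤ j ∧ j + 1 < k ∧ k < n ∧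
          x = fs n k * fs n j * (fs n j * fs n k)⁻¹) ∨
        (∃ k, 1 ≤ k ∧ k + 1 < n ∧
          x = fs n k * fs n (k+1) * fs n k * (fs n (k+1) * fs n k * fs n (k+1))⁻¹) ∨
        (∃ k, 2 ≤ k ∧ k < n ∧ x = fT n * fs n k * (fs n k * fT n)⁻¹) ∨
        (∃ k, 2 ≤ k ∧ k < n ∧ x = ftau n * fs n k * (fs n k * ftau n)⁻¹) ∨
        (1 < n ∧ x = fT n * fs n 1 * fT n * fs n 1 * (fs n 1 * fT n * fs n 1 * fT n)⁻¹) ∨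
        (1 < n ∧ x = ftau n * fs n 1 * ftau n * fs n 1 * (fs n 1 * ftau n * fs n 1 * ftau n)⁻¹) ∨
        (1 < n ∧ x = ftau n * (fs n 1 * fT n * fs n 1) * ((fs n 1 * fT n * fs n 1) * ftau n)⁻¹) }

/-- The mixed braid group `B_{2,n}` on two fixed strands. -/
abbrev B (n : ℕ) : Type := PresentedGroup (rels n)

/-- The group algebra `ℤ[q,q⁻¹] B_{2,n}`. -/
abbrev GA (n : ℕ) : Type := MonoidAlgebra R (B n)

/-- The image of `σ_i` in the group algebra. -/
def gA (n i : ℕ) : GA n := MonoidAlgebra.of R (B n) (PresentedGroup.mk (rels n) (fs n i))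

/-- The quadratic relations `σ_i² = (q-1)σ_i + q·1`, `i = 1, …, n-1`. -/
inductive quadRel (n : ℕ) : GA n → GA n → Prop
  | intro (i : ℕ) (h1 : 1 ≤ i) (h2 : i < n) :
      quadRel n (gA n i * gA n i) ((q - 1) • gA n i + q • (1 : GA n))

/-- The mixed Hecke algebra `H_{2,n}(q)`: the quotient of the group algebra `ℤ[q,q⁻¹] B_{2,n}`
by the two-sided ideal generated by the quadratic relations. -/
abbrev H (n : ℕ) : Type := RingQuot (quadRel n)

/-- The canonical monoid homomorphism `B_{2,n} →* H_{2,n}(q)`. -/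
def π (n : ℕ) : B n →* H n :=
  (RingQuot.mkAlgHom R (quadRel n)).toMonoidHom.comp (MonoidAlgebra.of R (B n))

/-- The canonical map from the free group on the generators to the units of `H_{2,n}(q)`
(images of group elements are units). -/
def U (n : ℕ) : FreeGroup (Gen n) →* (H n)ˣ :=
  ((π n).comp (PresentedGroup.mk (rels n))).toHomUnits

/-- The braiding generator `g_i` as a unit of `H_{2,n}(q)`. -/
def g (n i : ℕ) : (H n)ˣ := U n (fs n i)

/-- The word for the looping element `𝒯_i` : `𝒯_1 = 𝒯` and `𝒯_{i+1} = σ_i 𝒯_i σ_i`,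
i.e. `𝒯_i = σ_{i-1} ⋯ σ_1 𝒯 σ_1 ⋯ σ_{i-1}`. -/
def wT (n : ℕ) : ℕ → FreeGroup (Gen n)
  | 0 => 1
  | 1 => fT n
  | (i+2) => fs n (i+1) * wT n (i+1) * fs n (i+1)

/-- The word for the looping element `τ_i` : `τ_1 = τ` and `τ_{i+1} = σ_i τ_i σ_i`,
i.e. `τ_i = σ_{i-1} ⋯ σ_1 τ σ_1 ⋯ σ_{i-1}`. -/
def wtau (n : ℕ) : ℕ → FreeGroup (Gen n)
  | 0 => 1
  | 1 => ftau n
  | (i+2) => fs n (i+1) * wtau n (i+1) * fs n (i+1)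

/-- The looping element `𝒯_i` as a unit of `H_{2,n}(q)`. -/
def T (n i : ℕ) : (H n)ˣ := U n (wT n i)

/-- The looping element `τ_i` as a unit of `H_{2,n}(q)`. -/
def tau (n i : ℕ) : (H n)ˣ := U n (wtau n i)

/-- The loopings of index `i` : `𝒯_i, τ_i, 𝒯_i⁻¹, τ_i⁻¹`, as units of `H_{2,n}(q)`. -/
def LoopU (n i : ℕ) : Set (H n)ˣ := {T n i, tau n i, (T n i)⁻¹, (tau n i)⁻¹}

/-- The braiding generators `g_i`, `1 ≤ i ≤ n-1`, as elements of `H_{2,n}(q)`. -/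
def BraidGens (n : ℕ) : Set (H n) := {x | ∃ i, 1 ≤ i ∧ i < n ∧ x = (g n i : H n)}

/-- The elements `g_i^{±1}` with `lo ≤ i ≤ hi - 1`, as elements of `H_{2,n}(q)`. -/
def BraidPM (n lo hi : ℕ) : Set (H n) :=
  {x | ∃ i, lo ≤ i ∧ i < hi ∧ (x = (g n i : H n) ∨ x = ((g n i)⁻¹ : (H n)ˣ))}


/-- The element `G = g_j g_{j+1} ⋯ g_{i-2} g_{i-1} g_{i-2} ⋯ g_{j+1} g_j`
(which is `g_j` when `i = j+1`), as a unit of `H_{2,n}(q)`. -/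
def Gsym (n j i : ℕ) : (H n)ˣ :=
  (((List.range (i - 1 - j)).map (fun t => g n (j + t))).prod) * g n (i - 1) *
    (((List.range (i - 1 - j)).map (fun t => g n (i - 2 - t))).prod)

theorem U_eq_of_rel {n : ℕ} {x y : FreeGroup (Gen n)} (h : x * y⁻¹ ∈ rels n) :
    U n x = U n y := by
  have h1 : PresentedGroup.mk (rels n) (x * y⁻¹) = 1 := PresentedGroup.one_of_mem h
  have h2 : PresentedGroup.mk (rels n) x = PresentedGroup.mk (rels n) y := by
    rwa [map_mul, map_inv, mul_inv_eq_one] at h1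
  ext
  simp [U, h2]

theorem g_commute {n k j : ℕ} (hj : 1 ≤ j) (hjk : j + 1 < k) (hk : k < n) :
    Commute (g n k) (g n j) := by
  have := U_eq_of_rel (n := n) (x := fs n k * fs n j) (y := fs n j * fs n k)
    (Or.inl ⟨k, j, hj, hjk, hk, rfl⟩)
  rw [map_mul, map_mul] at this
  exact this

theorem g_braid {n k : ℕ} (hk : 1 ≤ k) (hkn : k + 1 < n) :
    g n k * g n (k + 1) * g n k = g n (k + 1) * g n k * g n (k + 1) := by
  have := U_eq_of_rel (n := n) (x := fs n k * fs n (k + 1) * fs n k)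
    (y := fs n (k + 1) * fs n k * fs n (k + 1)) (Or.inr (Or.inl ⟨k, hk, hkn, rfl⟩))
  simp only [map_mul] at this
  exact this

theorem T_one_commute_g {n k : ℕ} (hk : 2 ≤ k) (hkn : k < n) : Commute (T n 1) (g n k) := by
  have := U_eq_of_rel (n := n) (x := fT n * fs n k) (y := fs n k * fT n)
    (Or.inr (Or.inr (Or.inl ⟨k, hk, hkn, rfl⟩)))
  rw [map_mul, map_mul] at this
  exact this

theorem tau_one_commute_g {n k : ℕ} (hk : 2 ≤ k) (hkn : k < n) :
    Commute (tau n 1) (g n k) := by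
  have := U_eq_of_rel (n := n) (x := ftau n * fs n k) (y := fs n k * ftau n)
    (Or.inr (Or.inr (Or.inr (Or.inl ⟨k, hk, hkn, rfl⟩))))
  rw [map_mul, map_mul] at this
  exact this

theorem T_succ (n : ℕ) {i : ℕ} (hi : 1 ≤ i) : T n (i + 1) = g n i * T n i * g n i := by
  obtain ⟨i, rfl⟩ := Nat.exists_eq_add_of_le' hi
  simp only [T, g, wT, map_mul]

theorem tau_succ (n : ℕ) {i : ℕ} (hi : 1 ≤ i) :
    tau n (i + 1) = g n i * tau n i * g n i := by
  obtain ⟨i, rfl⟩ := Nat.exists_eq_add_of_le' hi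
  simp only [tau, g, wtau, map_mul]

theorem tau_one_commute_T_two {n : ℕ} (hn : 1 < n) : Commute (tau n 1) (T n 2) := by
  have := U_eq_of_rel (n := n) (x := ftau n * (fs n 1 * fT n * fs n 1))
    (y := (fs n 1 * fT n * fs n 1) * ftau n)
    (Or.inr (Or.inr (Or.inr (Or.inr (Or.inr (Or.inr ⟨hn, rfl⟩))))))
  simp only [map_mul] at this
  rw [T_succ n le_rfl]
  exact this

theorem T_commute_g {n j k : ℕ} (hj : 1 ≤ j) (hjk : j < k) (hk : k < n) :
    Commute (T n j) (g n k) := by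
  induction j, hj using Nat.le_induction with
  | base => exact T_one_commute_g hjk hk
  | succ j hj ih =>
    have hg := (g_commute hj hjk hk).symm
    rw [T_succ n hj]
    exact (hg.mul_left (ih (by omega))).mul_left hg

theorem tau_commute_g {n j k : ℕ} (hj : 1 ≤ j) (hjk : j < k) (hk : k < n) :
    Commute (tau n j) (g n k) := by
  induction j, hj using Nat.le_induction with
  | base => exact tau_one_commute_g hjk hk
  | succ j hj ih =>
    have hg := (g_commute hj hjk hk).symm
    rw [tau_succ n hj]
    exact (hg.mul_left (ih (by omega))).mul_left hg

/-- In any group, if `s`, `t` satisfy the braid relation and `t` commutes with `x`, then `s`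
commutes with `t s x s t`. -/
theorem commute_conj_of_braid {M : Type*} [Group M] {s t x : M} (hst : s * t * s = t * s * t)
    (hx : Commute x t) : Commute s (t * (s * x * s) * t) := by
  calc s * (t * (s * x * s) * t) = (s * t * s) * x * s * t := by group
    _ = t * s * (t * x) * s * t := by rw [hst]; group
    _ = t * s * x * (t * s * t) := by rw [← hx.eq]; group
    _ = t * (s * x * s) * t * s := by rw [← hst]; group

theorem tau_commute_T_succ {n j : ℕ} (hj : 1 ≤ j) (hjn : j < n) :
    Commute (tau n j) (T n (j + 1)) := by
  induction j, hj using Nat.le_induction with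
  | base => exact tau_one_commute_T_two hjn
  | succ j hj ih =>
    have hg := tau_commute_g hj (Nat.lt_succ_self j) hjn
    have hs : Commute (g n j) (T n (j + 1 + 1)) := by
      rw [T_succ n (i := j + 1) (by omega), T_succ n hj]
      exact commute_conj_of_braid (g_braid hj hjn) (T_commute_g hj (Nat.lt_succ_self j) hjn)
    have ht : Commute (tau n j) (T n (j + 1 + 1)) := by
      rw [T_succ n (i := j + 1) (by omega)]
      exact (hg.mul_right (ih (by omega))).mul_right hg
    rw [tau_succ n hj]
    exact (hs.mul_left ht).mul_left hs

theorem Gsym_self_succ (n j : ℕ) : Gsym n j (j + 1) = g n j := by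
  simp [Gsym]

theorem Gsym_succ {n j i : ℕ} (hj : 1 ≤ j) (hji : j < i) (hi : i < n) :
    Gsym n j (i + 1) = g n i * Gsym n j i * g n i := by
  obtain ⟨m, rfl⟩ := Nat.exists_eq_add_of_lt hji
  have e1 : j + m + 1 + 1 - 1 - j = m + 1 := by omega
  have e2 : j + m + 1 - 1 - j = m := by omega
  have h2 : ∀ t, j + m + 1 + 1 - 2 - (t + 1) = j + m + 1 - 2 - t := by omega
  have hP : Commute (g n (j + m + 1)) ((List.range m).map fun t => g n (j + t)).prod :=
    Commute.list_prod_right _ _ fun x hx => by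
      obtain ⟨t, ht, rfl⟩ := List.mem_map.1 hx
      rw [List.mem_range] at ht
      exact g_commute (by omega) (by omega) hi
  have hQ : Commute (g n (j + m + 1))
      ((List.range m).map fun t => g n (j + m + 1 - 2 - t)).prod :=
    Commute.list_prod_right _ _ fun x hx => by
      obtain ⟨t, ht, rfl⟩ := List.mem_map.1 hx
      rw [List.mem_range] at ht
      exact g_commute (by omega) (by omega) hi
  have hb := g_braid (n := n) (k := j + m) (by omega) hi
  have hL : Gsym n j (j + m + 1 + 1) =
      ((List.range m).map fun t => g n (j + t)).prod * g n (j + m) * g n (j + m + 1) *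
        (g n (j + m) * ((List.range m).map fun t => g n (j + m + 1 - 2 - t)).prod) := by
    unfold Gsym
    rw [e1]
    congr 1
    · rw [List.prod_range_succ]
      rfl
    · rw [List.prod_range_succ']
      simp only [h2]
      rfl
  rw [hL]
  unfold Gsym
  rw [e2]
  generalize ((List.range m).map fun t => g n (j + t)).prod = P at *
  generalize ((List.range m).map fun t => g n (j + m + 1 - 2 - t)).prod = Q at *
  simp only [Nat.add_sub_cancel]
  calc P * g n (j + m) * g n (j + m + 1) * (g n (j + m) * Q)
      = P * (g n (j + m) * g n (j + m + 1) * g n (j + m)) * Q := by group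
    _ = (P * g n (j + m + 1)) * g n (j + m) * (g n (j + m + 1) * Q) := by rw [hb]; group
    _ = g n (j + m + 1) * (P * g n (j + m) * Q) * g n (j + m + 1) := by
      rw [← hP.eq, hQ.eq]; group

/-- The elements `τ_i`, `𝒯_i` and `G` arise from `g_j τ_j g_j`, `g_j 𝒯_j g_j` and `g_j` by the
same two-sided multiplication, by elements commuting with `𝒯_j` and `τ_j`. -/
theorem exists_common_factors {n j i : ℕ} (hj : 1 ≤ j) (hji : j < i) (hi : i ≤ n) :
    ∃ C D : (H n)ˣ, tau n i = C * (g n j * tau n j * g n j) * D ∧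
      T n i = C * (g n j * T n j * g n j) * D ∧ Gsym n j i = C * g n j * D ∧
      Commute (T n j) C ∧ Commute (T n j) D ∧ Commute (tau n j) C ∧ Commute (tau n j) D := by
  induction i, hji using Nat.le_induction with
  | base =>
    refine ⟨1, 1, ?_, ?_, ?_, Commute.one_right _, Commute.one_right _, Commute.one_right _,
      Commute.one_right _⟩
    · simp [tau_succ n hj]
    · simp [T_succ n hj]
    · simp [Gsym_self_succ]
  | succ i hji ih =>
    obtain ⟨C, D, h1, h2, h3, hTC, hTD, htC, htD⟩ := ih (by omega)
    have hT := T_commute_g hj hji hi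
    have ht := tau_commute_g hj hji hi
    refine ⟨g n i * C, D * g n i, ?_, ?_, ?_, hT.mul_right hTC, hTD.mul_right hT,
      ht.mul_right htC, htD.mul_right ht⟩
    · rw [tau_succ n (by omega), h1]; group
    · rw [T_succ n (by omega), h2]; group
    · rw [Gsym_succ hj hji hi, h3]; group

theorem g_sq {n i : ℕ} (h1 : 1 ≤ i) (h2 : i < n) :
    (g n i : H n) * g n i = (q - 1) • (g n i : H n) + q • (1 : H n) := by
  have h := RingQuot.mkAlgHom_rel R (quadRel.intro i h1 h2)
  rwa [map_mul, map_add, map_smul, map_smul, map_one] at h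

theorem qinv_mul_q : qinv * q = 1 := by
  rw [qinv, q, ← LaurentPolynomial.T_add, neg_add_cancel, LaurentPolynomial.T_zero]

theorem g_eq {n i : ℕ} (h1 : 1 ≤ i) (h2 : i < n) :
    (g n i : H n) = q • (((g n i)⁻¹ : (H n)ˣ) : H n) + (q - 1) • (1 : H n) := by
  have h := congrArg (· * (((g n i)⁻¹ : (H n)ˣ) : H n)) (g_sq h1 h2)
  simp only [add_mul, smul_mul_assoc, mul_assoc, Units.mul_inv, mul_one, one_mul] at h
  rw [h, add_comm]

theorem g_add_smul_eq {n i : ℕ} (h1 : 1 ≤ i) (h2 : i < n) :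
    (1 : R) • (g n i : H n) + (1 - q) • (1 : H n) = q • (((g n i)⁻¹ : (H n)ˣ) : H n) := by
  rw [g_eq h1 h2, one_smul, add_assoc, ← add_smul]
  simp

/-- If `c s + d = e s'` with `c` invertible, an exchange relation for `s'` yields one for `s` up to
correction terms in which `s` is deleted. -/
theorem mem_span_of_exchange {A : Type*} [Semiring A] [Algebra R A] {a b a' b' s s' : A}
    {c c' d e : R} (hc : c' * c = 1) (hs : c • s + d • (1 : A) = e • s')
    (h : a * s' * b = a' * s' * b') :
    a * s * b ∈ Submodule.span R ({a' * s * b', a' * b', a * b} : Set A) := by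
  have expand (u v : A) : u * s * v + (c' * d) • (u * v) = (c' * e) • (u * s' * v) := by
    have h1 := congrArg (fun y => c' • (u * y * v)) hs
    simpa only [mul_add, add_mul, mul_smul_comm, smul_mul_assoc, mul_one, smul_add, smul_smul, hc,
      one_smul] using h1
  have h' : a * s * b = a' * s * b' + (c' * d) • (a' * b') + (-(c' * d)) • (a * b) := by
    rw [expand, ← h, ← expand, add_assoc, ← add_smul, add_neg_cancel, zero_smul, add_zero]
  rw [h']
  refine Submodule.add_mem _ (Submodule.add_mem _ ?_ (Submodule.smul_mem _ _ ?_))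
    (Submodule.smul_mem _ _ ?_) <;> exact Submodule.subset_span (by simp)

/-- **Lemma 3, item (3).** For `j < i`, with
`G = g_j g_{j+1} ⋯ g_{i-2} g_{i-1} g_{i-2} ⋯ g_{j+1} g_j`, the element
`τ_i^ε 𝒯_j^{-ε}` lies in the `ℤ[q,q⁻¹]`-submodule spanned by
`𝒯_j^{-ε} τ_i^ε`, `𝒯_j^{-ε} τ_j^ε G^ε` and `τ_i^ε 𝒯_i^{-ε} G^ε`. -/
theorem lemma3_item3 (n : ℕ) (hn : 1 ≤ n) (i j : ℕ) (hj : 1 ≤ j) (hji : j < i) (hi : i ≤ n)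
    (ε : ℤ) (hε : ε = 1 ∨ ε = -1) :
    ((tau n i ^ ε : (H n)ˣ) : H n) * ((T n j ^ (-ε) : (H n)ˣ) : H n) ∈
      Submodule.span R
        ({((T n j ^ (-ε) : (H n)ˣ) : H n) * ((tau n i ^ ε : (H n)ˣ) : H n),
          ((T n j ^ (-ε) : (H n)ˣ) : H n) * ((tau n j ^ ε : (H n)ˣ) : H n)
            * ((Gsym n j i ^ ε : (H n)ˣ) : H n),
          ((tau n i ^ ε : (H n)ˣ) : H n) * ((T n i ^ (-ε) : (H n)ˣ) : H n)
            * ((Gsym n j i ^ ε : (H n)ˣ) : H n)} : Set (H n)) := by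
  have hjn : j < n := lt_of_lt_of_le hji hi
  obtain ⟨C, D, h1, h2, h3, hTC, hTD, htC, htD⟩ := exists_common_factors hj hji hi
  have hc := tau_commute_T_succ hj hjn
  rw [T_succ n hj] at hc
  rw [h1, h2, h3]
  have hg := g_add_smul_eq hj hjn
  have hg' : q • (((g n j)⁻¹ : (H n)ˣ) : H n) + (q - 1) • (1 : H n) = (1 : R) • (g n j : H n) := by
    rw [one_smul, ← g_eq hj hjn]
  generalize tau n j = t at *
  generalize T n j = x at *
  generalize g n j = s at *
  rcases hε with rfl | rfl
  · have key : (C * s * t) * s⁻¹ * (x⁻¹ * D) = (C * x⁻¹) * s⁻¹ * (t * s * D) := by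
      have h := hc.inv_right.eq
      calc (C * s * t) * s⁻¹ * (x⁻¹ * D) = C * s * (t * (s * x * s)⁻¹) * s * D := by group
        _ = (C * x⁻¹) * s⁻¹ * (t * s * D) := by rw [h]; group
    have := mem_span_of_exchange (one_mul 1) hg (congrArg Units.val key)
    simp only [← Units.val_mul, zpow_neg, zpow_one] at this ⊢
    have e0 : C * (s * t * s) * D * x⁻¹ = C * s * t * s * (x⁻¹ * D) := by
      rw [hTD.inv_left.eq]; group
    have e1 : x⁻¹ * (C * (s * t * s) * D) = C * x⁻¹ * s * (t * s * D) := by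
      rw [← hTC.inv_left.eq]; group
    have e2 : x⁻¹ * t * (C * s * D) = C * x⁻¹ * (t * s * D) := by
      calc x⁻¹ * t * (C * s * D) = (x⁻¹ * t * C) * (s * D) := by group
        _ = C * x⁻¹ * (t * s * D) := by rw [(hTC.inv_left.mul_left htC).eq]; group
    have e3 : C * (s * t * s) * D * (C * (s * x * s) * D)⁻¹ * (C * s * D) =
        C * s * t * (x⁻¹ * D) := by group
    rw [e0, e1, e2, e3]
    exact this
  · have key : (D⁻¹ * s⁻¹ * t⁻¹) * s * (x * C⁻¹) = (D⁻¹ * x) * s * (t⁻¹ * s⁻¹ * C⁻¹) := by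
      have h := hc.inv_left.eq
      calc (D⁻¹ * s⁻¹ * t⁻¹) * s * (x * C⁻¹) = D⁻¹ * s⁻¹ * (t⁻¹ * (s * x * s)) * s⁻¹ * C⁻¹ := by
            group
        _ = (D⁻¹ * x) * s * (t⁻¹ * s⁻¹ * C⁻¹) := by rw [h]; group
    have := mem_span_of_exchange qinv_mul_q hg' (congrArg Units.val key)
    simp only [← Units.val_mul, zpow_neg, zpow_one, inv_inv] at this ⊢
    have e0 : (C * (s * t * s) * D)⁻¹ * x = D⁻¹ * s⁻¹ * t⁻¹ * s⁻¹ * (x * C⁻¹) := by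
      rw [hTC.inv_right.eq]; group
    have e1 : x * (C * (s * t * s) * D)⁻¹ = D⁻¹ * x * s⁻¹ * (t⁻¹ * s⁻¹ * C⁻¹) := by
      rw [← hTD.inv_right.eq]; group
    have e2 : x * t⁻¹ * (C * s * D)⁻¹ = D⁻¹ * x * (t⁻¹ * s⁻¹ * C⁻¹) := by
      calc x * t⁻¹ * (C * s * D)⁻¹ = (x * t⁻¹ * D⁻¹) * (s⁻¹ * C⁻¹) := by group
        _ = D⁻¹ * x * (t⁻¹ * s⁻¹ * C⁻¹) := by
          rw [(hTD.inv_right.mul_left htD.inv_inv).eq]; group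
    have e3 : (C * (s * t * s) * D)⁻¹ * (C * (s * x * s) * D) * (C * s * D)⁻¹ =
        D⁻¹ * s⁻¹ * t⁻¹ * (x * C⁻¹) := by group
    rw [e0, e1, e2, e3]
    exact this

end MixedHecke
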